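/- Let A be an abelian group isomorphic to Z/m × Z/m. The number ψ(m) of cyclic subgroups of A of order m satisfies ψ(m) = m · ∏_{p | m} (1 + 1/p), where the product runs over the prime divisors p of m. -/

import Mathlib

/-- Each element of order `m` generates exactly one cyclic subgroup of order `m`, and each such
subgroup has `φ(m)` generators. -/
theorem card_addOrderOf_eq_card_cyclic_mul_totient {G : Type*} [AddGroup G] [Finite G] (m : ℕ) :
    Nat.card {x : G // addOrderOf x = m} =
      Nat.card {B : AddSubgroup G // IsAddCyclic B ∧ Nat.card B = m} * m.totient := by
  classical
  let e : {x : G // addOrderOf x = m} ≃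
      Σ B : {B : AddSubgroup G // IsAddCyclic B ∧ Nat.card B = m},
        {y : B.1 // addOrderOf y = m} :=
    { toFun := fun x => ⟨⟨AddSubgroup.zmultiples x.1, inferInstance,
          (Nat.card_zmultiples x.1).trans x.2⟩,
          ⟨⟨x.1, AddSubgroup.mem_zmultiples x.1⟩, by rw [← AddSubgroup.addOrderOf_coe]; exact x.2⟩⟩
      invFun := fun z => ⟨z.2.1.1, by rw [AddSubgroup.addOrderOf_coe]; exact z.2.2⟩
      left_inv := fun _ => rfl
      right_inv := by
        rintro ⟨⟨B, hc, hB⟩, ⟨⟨y, hy⟩, hm⟩⟩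
        have hm' : addOrderOf y = m := by rw [← hm, ← AddSubgroup.addOrderOf_coe]
        obtain rfl : AddSubgroup.zmultiples y = B :=
          AddSubgroup.eq_of_le_of_card_ge (AddSubgroup.zmultiples_le_of_mem hy)
            (by rw [Nat.card_zmultiples, hm', hB])
        rfl }
  have := Fintype.ofFinite {B : AddSubgroup G // IsAddCyclic B ∧ Nat.card B = m}
  rw [Nat.card_congr e, Nat.card_sigma, Finset.sum_congr rfl (g := fun _ => m.totient),
    Finset.sum_const, Finset.card_univ, Nat.card_eq_fintype_card, smul_eq_mul]
  rintro ⟨B, hc, hB⟩ -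
  have := Fintype.ofFinite B
  rw [Nat.card_eq_fintype_card, Fintype.card_subtype]
  exact IsAddCyclic.card_addOrderOf_eq_totient (hB.symm.trans Nat.card_eq_fintype_card).dvd

theorem card_addOrderOf_eq_mul_of_coprime {G H : Type*} [AddGroup G] [AddGroup H] {a b : ℕ}
    (hab : a.Coprime b) (ha : ∀ x : G, a • x = 0) (hb : ∀ y : H, b • y = 0) :
    Nat.card {z : G × H // addOrderOf z = a * b} =
      Nat.card {x : G // addOrderOf x = a} * Nat.card {y : H // addOrderOf y = b} := by
  rw [← Nat.card_prod]
  refine Nat.card_congr ((Equiv.subtypeEquivRight fun z => ?_).trans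
    (Equiv.subtypeProdEquivProd (p := fun x : G => addOrderOf x = a)
      (q := fun y : H => addOrderOf y = b)))
  have h₁ := addOrderOf_dvd_of_nsmul_eq_zero (ha z.1)
  have h₂ := addOrderOf_dvd_of_nsmul_eq_zero (hb z.2)
  have hc := Nat.Coprime.of_dvd h₁ h₂ hab
  rw [Prod.addOrderOf, hc.lcm_eq_mul]
  refine ⟨fun h => ⟨?_, ?_⟩, fun h => by rw [h.1, h.2]⟩
  · exact Nat.dvd_antisymm h₁
      ((hab.of_dvd_right h₂).dvd_of_dvd_mul_right (h ▸ dvd_mul_right a b))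
  · exact Nat.dvd_antisymm h₂
      ((hab.of_dvd_left h₁).symm.dvd_of_dvd_mul_left (h ▸ dvd_mul_left b a))

theorem nsmul_zmod_prod_eq_zero (m : ℕ) (x : ZMod m × ZMod m) : m • x = 0 := by
  ext <;> simp

theorem card_addOrderOf_zmod_prod_mul {a b : ℕ} (hab : a.Coprime b) :
    Nat.card {x : ZMod (a * b) × ZMod (a * b) // addOrderOf x = a * b} =
      Nat.card {x : ZMod a × ZMod a // addOrderOf x = a} *
        Nat.card {x : ZMod b × ZMod b // addOrderOf x = b} := by
  rw [← card_addOrderOf_eq_mul_of_coprime hab (nsmul_zmod_prod_eq_zero a)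
    (nsmul_zmod_prod_eq_zero b)]
  let f := (ZMod.chineseRemainder hab).toAddEquiv
  let e := (f.prodCongr f).trans (AddEquiv.prodProdProdComm _ _ _ _)
  exact Nat.card_congr (e.toEquiv.subtypeEquiv fun x => by
    rw [← AddEquiv.addOrderOf_eq e x]; rfl)

theorem card_nsmul_eq_zero_zmod_prod {d m : ℕ} [NeZero m] (hd : d ∣ m) :
    Nat.card {x : ZMod m × ZMod m // d • x = 0} = d ^ 2 := by
  have h : Nat.card {x : ZMod m // d • x = 0} = d := by
    have := IsAddCyclic.card_nsmulAddMonoidHom_ker (G := ZMod m) d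
    rw [Nat.card_zmod, Nat.gcd_eq_right hd] at this
    exact this
  refine Eq.trans ?_ (congrArg (· ^ 2) h)
  rw [sq, ← Nat.card_prod]
  exact Nat.card_congr ((Equiv.subtypeEquivRight fun z => by simp [Prod.ext_iff]).trans
    (Equiv.subtypeProdEquivProd (p := fun x : ZMod m => d • x = 0)
      (q := fun x : ZMod m => d • x = 0)))

theorem card_addOrderOf_zmod_prod_prime_pow {p : ℕ} (hp : p.Prime) (n : ℕ) :
    Nat.card {x : ZMod (p ^ (n + 1)) × ZMod (p ^ (n + 1)) // addOrderOf x = p ^ (n + 1)} +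
      (p ^ n) ^ 2 = (p ^ (n + 1)) ^ 2 := by
  have : Fact p.Prime := ⟨hp⟩
  have : NeZero (p ^ (n + 1)) := ⟨pow_ne_zero _ hp.ne_zero⟩
  rw [← card_nsmul_eq_zero_zmod_prod (pow_dvd_pow p n.le_succ), ← Nat.card_sum]
  have hcard : Nat.card (ZMod (p ^ (n + 1)) × ZMod (p ^ (n + 1))) = (p ^ (n + 1)) ^ 2 := by
    rw [Nat.card_prod, Nat.card_zmod, sq]
  rw [← hcard]
  classical
  refine Nat.card_congr ((Equiv.sumComm _ _).trans (((Equiv.refl _).sumCongr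
    (Equiv.subtypeEquivRight fun x => ⟨fun h h0 => ?_, fun h => ?_⟩)).trans
      (Equiv.sumCompl fun x => p ^ n • x = 0)))
  · have := Nat.le_of_dvd (pow_pos hp.pos n) (h ▸ addOrderOf_dvd_of_nsmul_eq_zero h0)
    exact absurd this (not_le.2 (Nat.pow_lt_pow_right hp.one_lt n.lt_succ_self))
  · exact addOrderOf_eq_prime_pow h (nsmul_zmod_prod_eq_zero _ x)

/-- The number of elements of order `m` in `ZMod m × ZMod m` is Jordan's totient `J₂(m)`. -/
theorem card_addOrderOf_zmod_prod (m : ℕ) (hm : 0 < m) :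
    (Nat.card {x : ZMod m × ZMod m // addOrderOf x = m} : ℚ) =
      m ^ 2 * ∏ p ∈ m.primeFactors, (1 - 1 / (p : ℚ) ^ 2) := by
  induction m using Nat.recOnPosPrimePosCoprime with
  | zero => exact absurd hm (lt_irrefl 0)
  | one =>
    rw [Nat.card_congr (Equiv.subtypeUnivEquiv fun x => by
      rw [AddMonoid.addOrderOf_eq_one_iff]; exact Subsingleton.elim _ _)]
    simp
  | prime_pow p n hp hn =>
    obtain ⟨k, rfl⟩ := Nat.exists_eq_succ_of_ne_zero hn.ne'
    have h := congrArg (Nat.cast : ℕ → ℚ) (card_addOrderOf_zmod_prod_prime_pow hp k)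
    push_cast at h
    have hp0 : (p : ℚ) ≠ 0 := Nat.cast_ne_zero.2 hp.ne_zero
    rw [Nat.primeFactors_prime_pow k.succ_ne_zero hp, Finset.prod_singleton,
      eq_sub_of_add_eq h]
    push_cast
    field_simp
    ring
  | coprime a b ha hb hab iha ihb =>
    rw [card_addOrderOf_zmod_prod_mul hab, hab.primeFactors_mul,
      Finset.prod_union hab.disjoint_primeFactors]
    push_cast
    rw [iha (by omega), ihb (by omega)]
    ring

/-- The number of cyclic subgroups of order `m` in `ZMod m × ZMod m` is
`ψ(m) = m · ∏_{p | m} (1 + 1/p)`. -/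
theorem stmt0 (m : ℕ) (hm : 0 < m) :
    (Nat.card {B : AddSubgroup (ZMod m × ZMod m) //
        IsAddCyclic B ∧ Nat.card B = m} : ℚ) =
      m * ∏ p ∈ m.primeFactors, (1 + 1 / (p : ℚ)) := by
  have : NeZero m := ⟨hm.ne'⟩
  have h := congrArg (Nat.cast : ℕ → ℚ)
    (card_addOrderOf_eq_card_cyclic_mul_totient (G := ZMod m × ZMod m) m)
  rw [Nat.cast_mul, card_addOrderOf_zmod_prod m hm] at h
  have hφ : (m.totient : ℚ) ≠ 0 := Nat.cast_ne_zero.2 (Nat.totient_pos.2 hm).ne'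
  refine mul_right_cancel₀ hφ (h.symm.trans ?_)
  rw [Nat.totient_eq_mul_prod_factors, mul_mul_mul_comm, ← Finset.prod_mul_distrib, ← sq]
  congr 1
  refine Finset.prod_congr rfl fun p _ => ?_
  ring
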